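/- arXiv:1906.03154 — 2 statements merged into one kernel-verified Lean document; each statement's English description precedes it below -/
import Mathlib

section
/- Let m ≥ 3 be an integer and let A_m be the dihedral Artin group on generators s, t with exponent m. Let Δ denote the image in A_m of the alternating word prod(s,t;m). Then the centre of A_m is the cyclic subgroup generated by Δ when m is even, and the cyclic subgroup generated by Δ² when m is odd; i.e., Subgroup.center A_m = Subgroup.zpowers z, where z = Δ for m even and z = Δ² for m odd. -/
/-- The alternating product `a b a b ⋯` with `k` letters, starting with `a`. -/
def altProd {G : Type*} [Monoid G] (a b : G) : ℕ → G
  | 0 => 1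
  | n + 1 => a * altProd b a n

/-- The braid relation `prod(s,t;m) = prod(t,s;m)` for the dihedral Artin group,
as a single relator in the free group on two generators. -/
def braidRels (m : ℕ) : Set (FreeGroup (Fin 2)) :=
  {altProd (FreeGroup.of 0) (FreeGroup.of 1) m * (altProd (FreeGroup.of 1) (FreeGroup.of 0) m)⁻¹}

/-- The dihedral Artin group `⟨s, t | prod(s,t;m) = prod(t,s;m)⟩`. -/
abbrev DihedralArtin (m : ℕ) : Type := PresentedGroup (braidRels m)

/-- The generators of the dihedral Artin group: `s = Dgen m 0` and `t = Dgen m 1`. -/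
def Dgen (m : ℕ) (i : Fin 2) : DihedralArtin m := PresentedGroup.of i

/-- The Garside element `Δ`, the image of `prod(s,t;m)` in the dihedral Artin group. -/
def DDelta (m : ℕ) : DihedralArtin m := altProd (Dgen m 0) (Dgen m 1) m

/-- The central element `z`: equal to `Δ` for `m` even and to `Δ²` for `m` odd. -/
def Dz (m : ℕ) : DihedralArtin m := if Even m then DDelta m else (DDelta m) ^ 2

/-- The conjugate `g H g⁻¹` of a subgroup. -/
def conjSub {G : Type*} [Group G] (g : G) (H : Subgroup G) : Subgroup G :=
  H.map (MulAut.conj g).toMonoidHom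

namespace Monoid.CoprodI

variable {ι : Type*} {M : ι → Type*}

/-- Multiplying a reduced word by an element of the factor of its first letter does not
lengthen it. -/
theorem Word.length_of_smul_le [DecidableEq ι] [∀ i, Group (M i)] [∀ i, DecidableEq (M i)]
    {i : ι} (h : M i) (w : Word M) (hw : w.fstIdx = some i) :
    (of h • w).toList.length ≤ w.toList.length := by
  induction w using Word.consRecOn with
  | empty => simp [Word.fstIdx, Word.empty] at hw
  | cons j m w h1 h2 ih =>
    rw [Word.fstIdx_cons, Option.some_inj] at hw
    subst hw
    rw [Word.cons_eq_smul, ← mul_smul, ← map_mul, ← Word.cons_eq_smul (h1 := h1) (h2 := h2)]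
    by_cases hm : h * m = 1
    · simp [hm, Word.cons]
    · rw [← Word.cons_eq_smul (h1 := h1) (h2 := hm)]
      simp [Word.cons]

/-- An element of a free product of groups that commutes with a nontrivial element of each of at
least two factors is trivial. -/
theorem eq_one_of_commute_of [Nontrivial ι] [∀ i, Group (M i)] {g : CoprodI M} {h : ∀ i, M i}
    (h_ne : ∀ i, h i ≠ 1) (hg : ∀ i, Commute g (of (h i))) : g = 1 := by
  classical
  by_contra hg1
  obtain ⟨i, j, w, hw⟩ := NeWord.of_word (Word.equiv g) fun h0 => hg1 <| by
    rw [← Word.equiv.symm_apply_apply g, h0]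
    exact Word.prod_empty
  have hwg : w.prod = g := by
    rw [NeWord.prod, hw]
    exact Word.equiv.symm_apply_apply g
  have fst_eq : ∀ {a b : ι} (v : NeWord M a b), v.toWord.fstIdx = some a := fun v => by
    simp [Word.fstIdx, NeWord.toWord, NeWord.toList_head?]
  have word_inj : ∀ {v v' : Word M}, v.prod = v'.prod → v = v' := fun hv =>
    Word.equiv.symm.injective hv
  by_cases hij : i = j
  · subst hij
    obtain ⟨k, hk⟩ := exists_ne i
    let x := NeWord.singleton (h k) (h_ne k)
    have heq : (NeWord.append x hk w).toWord = (NeWord.append w hk.symm x).toWord := by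
      apply word_inj
      change NeWord.prod _ = NeWord.prod _
      rw [NeWord.append_prod, NeWord.append_prod, NeWord.prod_singleton, hwg]
      exact (hg k).symm
    have := congrArg Word.fstIdx heq
    rw [fst_eq, fst_eq, Option.some_inj] at this
    exact hk this
  · let x := NeWord.singleton (h i) (h_ne i)
    have heq : (NeWord.append w (Ne.symm hij) x).toWord = of (h i) • w.toWord := by
      apply word_inj
      rw [Word.prod_smul]
      change NeWord.prod _ = _ * w.prod
      rw [NeWord.append_prod, NeWord.prod_singleton, hwg]
      exact hg i
    have hle := Word.length_of_smul_le (h i) w.toWord (fst_eq w)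
    rw [← heq] at hle
    simp [NeWord.toWord, NeWord.toList, x] at hle

end Monoid.CoprodI

open Monoid (CoprodI)

/-- The homomorphism from the cyclic group of order `n` sending the generator to an element `g`
with `g ^ n = 1`. -/
def zmodPowersHom {G : Type*} [Group G] (n : ℕ) (g : G) (hg : g ^ n = 1) :
    Multiplicative (ZMod n) →* G :=
  AddMonoidHom.toMultiplicativeLeft <|
    ZMod.lift n ⟨zmultiplesHom (Additive G) (Additive.ofMul g), by
      simpa [← ofMul_pow] using hg⟩

theorem zmodPowersHom_ofAdd_one {G : Type*} [Group G] (n : ℕ) (g : G) (hg : g ^ n = 1) :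
    zmodPowersHom n g hg (Multiplicative.ofAdd 1) = g := by
  have := ZMod.lift_coe n (⟨zmultiplesHom (Additive G) (Additive.ofMul g), by
      simpa [← ofMul_pow] using hg⟩ : {f : ℤ →+ Additive G // f n = 0}) 1
  simp only [Int.cast_one, zmultiplesHom_apply, one_smul] at this
  exact this

/-- The generator of the `i`-th factor in a free product of cyclic groups. -/
def cyclicGen {ι : Type*} (n : ι → ℕ) (i : ι) : CoprodI fun i => Multiplicative (ZMod (n i)) :=
  CoprodI.of (i := i) (Multiplicative.ofAdd (1 : ZMod (n i)))

theorem cyclicGen_pow {ι : Type*} (n : ι → ℕ) (i : ι) : cyclicGen n i ^ n i = 1 := by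
  rw [cyclicGen, ← map_pow, ← ofAdd_nsmul]
  simp

/-- If a quotient by a central cyclic subgroup is a free product of at least two nontrivial cyclic
groups, then that subgroup contains the centre. -/
theorem center_le_zpowers_of_coprodI {ι G : Type*} [Nontrivial ι] [Group G] {z : G}
    (hz : z ∈ Subgroup.center G) (n : ι → ℕ) (hn : ∀ i, n i ≠ 1) (u : ι → G)
    (hu : ∀ i, u i ^ n i ∈ Subgroup.zpowers z) (hgen : Subgroup.closure (Set.range u) = ⊤)
    (φ : G →* CoprodI fun i => Multiplicative (ZMod (n i)))
    (hφ : ∀ i, φ (u i) = cyclicGen n i) :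
    Subgroup.center G ≤ Subgroup.zpowers z := by
  intro c hc
  have : (Subgroup.zpowers z).Normal := ⟨fun x hx g => by
    rwa [Subgroup.mem_center_iff.mp (Subgroup.zpowers_le.mpr hz hx) g, mul_inv_cancel_right]⟩
  let ψ : CoprodI (fun i => Multiplicative (ZMod (n i))) →* G ⧸ Subgroup.zpowers z :=
    CoprodI.lift fun i => zmodPowersHom (n i) (u i : G ⧸ Subgroup.zpowers z) <| by
      rw [← QuotientGroup.mk_pow, QuotientGroup.eq_one_iff]
      exact hu i
  have hψ : ψ.comp φ = QuotientGroup.mk' (Subgroup.zpowers z) := by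
    apply MonoidHom.eq_of_eqOn_dense hgen
    rintro _ ⟨i, rfl⟩
    simp only [MonoidHom.comp_apply, hφ, ψ, cyclicGen, CoprodI.lift_of, zmodPowersHom_ofAdd_one,
      QuotientGroup.mk'_apply]
  have h1 : φ c = 1 := by
    refine CoprodI.eq_one_of_commute_of (h := fun i => Multiplicative.ofAdd (1 : ZMod (n i)))
      (fun i h => ?_) fun i => ?_
    · have : Nontrivial (ZMod (n i)) := ZMod.nontrivial_iff.mpr (hn i)
      exact one_ne_zero (ofAdd_eq_one.mp h)
    · change Commute (φ c) (cyclicGen n i)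
      rw [← hφ]
      exact Commute.map (Subgroup.mem_center_iff.mp hc (u i)).symm φ
  have h2 := DFunLike.congr_fun hψ c
  rw [MonoidHom.comp_apply, h1, map_one] at h2
  exact (QuotientGroup.eq_one_iff c).mp h2.symm

theorem mul_pow_mul_comm {G : Type*} [Monoid G] (a b : G) (k : ℕ) :
    a * (b * a) ^ k = (a * b) ^ k * a :=
  (show SemiconjBy a (b * a) (a * b) from (mul_assoc a b a).symm).pow_right k

theorem altProd_two_mul {G : Type*} [Monoid G] (a b : G) (k : ℕ) :
    altProd a b (2 * k) = (a * b) ^ k := by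
  induction k with
  | zero => rw [mul_zero, pow_zero, altProd]
  | succ k ih => rw [Nat.mul_succ, altProd, altProd, ih, pow_succ', mul_assoc]

theorem altProd_two_mul_add_one {G : Type*} [Monoid G] (a b : G) (k : ℕ) :
    altProd a b (2 * k + 1) = (a * b) ^ k * a := by
  rw [altProd, altProd_two_mul, mul_pow_mul_comm]

theorem map_altProd {G H : Type*} [Monoid G] [Monoid H] (f : G →* H) (a b : G) (n : ℕ) :
    f (altProd a b n) = altProd (f a) (f b) n := by
  induction n generalizing a b with
  | zero => exact map_one f
  | succ n ih => rw [altProd, altProd, map_mul, ih]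

namespace DihedralArtin

theorem braid (m : ℕ) :
    altProd (Dgen m 0) (Dgen m 1) m = altProd (Dgen m 1) (Dgen m 0) m := by
  have h := PresentedGroup.mk_eq_one_iff.mpr
    (Subgroup.subset_normalClosure (Set.mem_singleton _ : _ ∈ braidRels m))
  rw [map_mul, map_inv, map_altProd, map_altProd, mul_inv_eq_one] at h
  exact h

/-- The homomorphism out of the dihedral Artin group determined by a pair satisfying the braid
relation. -/
def lift {H : Type*} [Group H] (m : ℕ) (a b : H) (hab : altProd a b m = altProd b a m) :
    DihedralArtin m →* H :=
  PresentedGroup.toGroup (f := ![a, b]) <| by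
    rintro r rfl
    rw [map_mul, map_inv, map_altProd, map_altProd, mul_inv_eq_one]
    simpa using hab

section Lift

variable {H : Type*} [Group H] (m : ℕ) (a b : H) (hab : altProd a b m = altProd b a m)

theorem lift_zero : lift m a b hab (Dgen m 0) = a := by
  simp [lift, Dgen]

theorem lift_one : lift m a b hab (Dgen m 1) = b := by
  simp [lift, Dgen]

end Lift

theorem eq_top_of_gen_mem {m : ℕ} {K : Subgroup (DihedralArtin m)} (h0 : Dgen m 0 ∈ K)
    (h1 : Dgen m 1 ∈ K) : K = ⊤ := by
  rw [eq_top_iff, ← PresentedGroup.closure_range_of, Subgroup.closure_le]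
  rintro _ ⟨i, rfl⟩
  fin_cases i
  exacts [h0, h1]

theorem mem_center {m : ℕ} {z : DihedralArtin m} (h0 : Commute (Dgen m 0) z)
    (h1 : Commute (Dgen m 1) z) : z ∈ Subgroup.center (DihedralArtin m) := by
  have h : Subgroup.centralizer {z} = ⊤ := eq_top_of_gen_mem
    (Subgroup.mem_centralizer_singleton_iff.mpr h0)
    (Subgroup.mem_centralizer_singleton_iff.mpr h1)
  exact Subgroup.mem_center_iff.mpr fun g =>
    Subgroup.mem_centralizer_singleton_iff.mp (h ▸ Subgroup.mem_top g)

theorem center_even {k : ℕ} (hk : k ≠ 1) :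
    Subgroup.center (DihedralArtin (2 * k)) = Subgroup.zpowers (DDelta (2 * k)) := by
  have hb := braid (2 * k)
  set s := Dgen (2 * k) 0 with hs
  set t := Dgen (2 * k) 1 with ht
  have hΔ : DDelta (2 * k) = (s * t) ^ k := altProd_two_mul s t k
  rw [altProd_two_mul, altProd_two_mul] at hb
  have hz : DDelta (2 * k) ∈ Subgroup.center (DihedralArtin (2 * k)) := by
    rw [hΔ]
    apply mem_center
    · rw [← hs, Commute, SemiconjBy]
      conv_lhs => rw [hb, mul_pow_mul_comm]
    · rw [← ht, Commute, SemiconjBy, mul_pow_mul_comm, hb]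
  refine le_antisymm ?_ (Subgroup.zpowers_le.mpr hz)
  let n : Fin 2 → ℕ := ![0, k]
  have hx : cyclicGen n 1 ^ k = 1 := cyclicGen_pow n 1
  let φ := lift (2 * k) (cyclicGen n 0) ((cyclicGen n 0)⁻¹ * cyclicGen n 1) <| by
    rw [altProd_two_mul, altProd_two_mul, mul_inv_cancel_left, hx]
    have := conj_pow (i := k) (a := (cyclicGen n 0)⁻¹) (b := cyclicGen n 1)
    rw [hx, inv_inv, mul_one, inv_mul_cancel] at this
    exact this.symm
  refine center_le_zpowers_of_coprodI hz n ?_ ![s, s * t] ?_ ?_ φ ?_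
  · simp [Fin.forall_fin_two, n, hk]
  · simp [Fin.forall_fin_two, n, hΔ]
  · have h0 : s ∈ Subgroup.closure (Set.range ![s, s * t]) :=
      Subgroup.subset_closure ⟨0, rfl⟩
    have h1 : s * t ∈ Subgroup.closure (Set.range ![s, s * t]) :=
      Subgroup.subset_closure ⟨1, rfl⟩
    exact eq_top_of_gen_mem h0 ((Subgroup.mul_mem_cancel_left _ h0).mp h1)
  · rw [Fin.forall_fin_two]
    constructor
    · exact lift_zero ..
    · change φ (s * t) = _
      rw [map_mul, lift_zero, lift_one, mul_inv_cancel_left]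

theorem center_odd {k : ℕ} (hk : k ≠ 0) :
    Subgroup.center (DihedralArtin (2 * k + 1)) =
      Subgroup.zpowers (DDelta (2 * k + 1) ^ 2) := by
  have hb := braid (2 * k + 1)
  set s := Dgen (2 * k + 1) 0 with hs
  set t := Dgen (2 * k + 1) 1 with ht
  have hΔ : DDelta (2 * k + 1) = (s * t) ^ k * s := altProd_two_mul_add_one s t k
  rw [altProd_two_mul_add_one, altProd_two_mul_add_one] at hb
  set d := DDelta (2 * k + 1)
  have hsd : s * d = d * t := by
    conv_lhs => rw [hΔ, hb, ← mul_assoc, mul_pow_mul_comm, ← hΔ]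
  have htd : t * d = d * s := by
    conv_lhs => rw [hΔ, ← mul_assoc, mul_pow_mul_comm, ← hb, ← hΔ]
  have hsq : (s * t) ^ (2 * k + 1) = d ^ 2 := by
    rw [sq]
    nth_rw 1 [hΔ]
    rw [mul_assoc, hsd, hΔ, mul_assoc, ← pow_succ, ← pow_add]
    congr 1
    omega
  have hz : d ^ 2 ∈ Subgroup.center (DihedralArtin (2 * k + 1)) := by
    apply mem_center
    · rw [← hs, Commute, SemiconjBy, sq, ← mul_assoc, hsd, mul_assoc, htd, mul_assoc]
    · rw [← ht, Commute, SemiconjBy, sq, ← mul_assoc, htd, mul_assoc, hsd, mul_assoc]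
  refine le_antisymm ?_ (Subgroup.zpowers_le.mpr hz)
  let n : Fin 2 → ℕ := ![2, 2 * k + 1]
  set y := cyclicGen n 0
  set x := cyclicGen n 1
  have hy2 : y ^ 2 = 1 := cyclicGen_pow n 0
  have hxm : x ^ (2 * k + 1) = 1 := cyclicGen_pow n 1
  have hxy : (x ^ k)⁻¹ * y * (y⁻¹ * x ^ (k + 1)) = x := by
    rw [pow_succ]
    group
  let φ := lift (2 * k + 1) ((x ^ k)⁻¹ * y) (y⁻¹ * x ^ (k + 1)) <| by
    rw [altProd_two_mul_add_one, altProd_two_mul_add_one,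
      ← mul_pow_mul_comm (y⁻¹ * x ^ (k + 1)), hxy, mul_inv_cancel_left, mul_assoc, ← pow_add, show k + 1 + k = 2 * k + 1 by omega, hxm, mul_one]
    exact eq_inv_of_mul_eq_one_left (by rw [← sq, hy2])
  have hφ : φ (s * t) = x := by
    rw [map_mul, lift_zero, lift_one, hxy]
  refine center_le_zpowers_of_coprodI hz n ?_ ![d, s * t] ?_ ?_ φ ?_
  · simp [Fin.forall_fin_two, n, hk]
  · simp [Fin.forall_fin_two, n, hsq]
  · have h0 : d ∈ Subgroup.closure (Set.range ![d, s * t]) :=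
      Subgroup.subset_closure ⟨0, rfl⟩
    have h1 : s * t ∈ Subgroup.closure (Set.range ![d, s * t]) :=
      Subgroup.subset_closure ⟨1, rfl⟩
    have h2 : s ∈ Subgroup.closure (Set.range ![d, s * t]) :=
      (Subgroup.mul_mem_cancel_left _ (pow_mem h1 k)).mp (hΔ ▸ h0)
    exact eq_top_of_gen_mem h2 ((Subgroup.mul_mem_cancel_left _ h2).mp h1)
  · rw [Fin.forall_fin_two]
    constructor
    · change φ d = y
      rw [hΔ, map_mul, map_pow, hφ, lift_zero, mul_inv_cancel_left]
    · exact hφ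

end DihedralArtin

/-- For `m ≥ 3`, the centre of the dihedral Artin group `A_m` is the cyclic
subgroup generated by `z`, where `z = Δ` for `m` even and `z = Δ²` for `m` odd. -/
theorem dihedralArtin_center (m : ℕ) (hm : 3 ≤ m) :
    Subgroup.center (DihedralArtin m) = Subgroup.zpowers (Dz m) := by
  obtain ⟨k, rfl | rfl⟩ := m.even_or_odd'
  · rw [Dz, if_pos (even_two_mul k)]
    exact DihedralArtin.center_even (by omega)
  · rw [Dz, if_neg (Nat.not_even_two_mul_add_one k)]
    exact DihedralArtin.center_odd (by omega)
end

section
/- There exists a real number ε > 0 such that: (i) for every integer m ≥ 2, (π/2 + ε) + (π/(2m) + ε) ≤ π − ε; and (ii) for every set S, every symmetric function M : S → S → ℕ∞ with M s t ≥ 2 for all s ≠ t which is of hyperbolic type (meaning 1/(M s t) + 1/(M t r) + 1/(M s r) < 1 for all pairwise distinct s, t, r ∈ S, with the convention 1/∞ = 0), every integer k ≥ 3, and every tuple s_0, …, s_{k−1} of pairwise distinct elements of S such that m_i := M s_i s_{(i+1) mod k} is finite for every 0 ≤ i ≤ k−1, one has Σ_{i=0}^{k−1} (θ(m_i, ε)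 − ε) ≥ π + ε, where θ(m, ε) := (m−1)π/(2m) − 2ε. -/
/-- `θ(m, ε) = (m−1)π/(2m) − 2ε`, the third angle of a Euclidean triangle with angles
`π/2 + ε` and `π/(2m) + ε`. -/
noncomputable def theta (m : ℕ) (ε : ℝ) : ℝ := ((m : ℝ) - 1) * Real.pi / (2 * m) - 2 * ε

/-- `1/m` as a real number, for `m ∈ {2, 3, …, ∞}`, with the convention `1/∞ = 0`. -/
noncomputable def expInv (n : ℕ∞) : ℝ := ((n.toNat : ℕ) : ℝ)⁻¹

/-- A sum of three unit fractions with denominators `2 ≤ a ≤ b ≤ c` that is less than `1` is at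
most `41/42 = 1/2 + 1/3 + 1/7`. -/
lemma inv_add_inv_add_inv_le_of_sorted {a b c : ℕ} (ha : 2 ≤ a) (hab : a ≤ b) (hbc : b ≤ c)
    (h : (a : ℝ)⁻¹ + (b : ℝ)⁻¹ + (c : ℝ)⁻¹ < 1) :
    (a : ℝ)⁻¹ + (b : ℝ)⁻¹ + (c : ℝ)⁻¹ ≤ 41 / 42 := by
  have inv_le : ∀ n m : ℕ, 0 < n → n ≤ m → (m : ℝ)⁻¹ ≤ (n : ℝ)⁻¹ := fun n m hn hnm ↦
    inv_anti₀ (by exact_mod_cast hn) (by exact_mod_cast hnm)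
  have lt_c : ∀ n : ℕ, 0 < n → (a : ℝ)⁻¹ + (b : ℝ)⁻¹ + (n : ℝ)⁻¹ ≥ 1 → n < c := by
    intro n _ hn
    by_contra! hcn
    linarith [inv_le c n (by omega) hcn]
  obtain rfl | rfl | ha4 : a = 2 ∨ a = 3 ∨ 4 ≤ a := by omega
  · obtain rfl | rfl | rfl | hb5 : b = 2 ∨ b = 3 ∨ b = 4 ∨ 5 ≤ b := by omega
    · have : (0 : ℝ) ≤ (c : ℝ)⁻¹ := by positivity
      norm_num at h
      linarith
    · have := inv_le 7 c (by norm_num) (lt_c 6 (by norm_num) (by norm_num))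
      norm_num at this ⊢
      linarith
    · have := inv_le 5 c (by norm_num) (lt_c 4 (by norm_num) (by norm_num))
      norm_num at this ⊢
      linarith
    · have h₁ := inv_le 5 b (by norm_num) hb5
      have h₂ := inv_le 5 c (by norm_num) (hb5.trans hbc)
      norm_num at h₁ h₂ ⊢
      linarith
  · have h₁ := inv_le 3 b (by norm_num) hab
    have h₂ : 4 ≤ c := by
      by_contra! hc
      obtain rfl : c = 3 := by omega
      obtain rfl : b = 3 := by omega
      norm_num at h
    have h₃ := inv_le 4 c (by norm_num) h₂
    norm_num at h₁ h₃ ⊢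
    linarith
  · have h₁ := inv_le 4 a (by norm_num) ha4
    have h₂ := inv_le 4 b (by norm_num) (by omega)
    have h₃ := inv_le 4 c (by norm_num) (by omega)
    norm_num at h₁ h₂ h₃ ⊢
    linarith

/-- A sum of three unit fractions with denominators at least `2` that is less than `1` is at
most `41/42`. -/
lemma inv_add_inv_add_inv_le {a b c : ℕ} (ha : 2 ≤ a) (hb : 2 ≤ b) (hc : 2 ≤ c)
    (h : (a : ℝ)⁻¹ + (b : ℝ)⁻¹ + (c : ℝ)⁻¹ < 1) :
    (a : ℝ)⁻¹ + (b : ℝ)⁻¹ + (c : ℝ)⁻¹ ≤ 41 / 42 := by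
  rcases le_total a b with h₁ | h₁ <;> rcases le_total b c with h₂ | h₂ <;>
    rcases le_total a c with h₃ | h₃
  · exact inv_add_inv_add_inv_le_of_sorted ha h₁ h₂ h
  · exact inv_add_inv_add_inv_le_of_sorted ha h₁ h₂ h
  · linarith [inv_add_inv_add_inv_le_of_sorted ha h₃ h₂ (by linarith)]
  · linarith [inv_add_inv_add_inv_le_of_sorted hc h₃ h₁ (by linarith)]
  · linarith [inv_add_inv_add_inv_le_of_sorted hb h₁ h₃ (by linarith)]
  · linarith [inv_add_inv_add_inv_le_of_sorted hb h₂ h₃ (by linarith)]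
  · linarith [inv_add_inv_add_inv_le_of_sorted hc h₂ h₁ (by linarith)]
  · linarith [inv_add_inv_add_inv_le_of_sorted hc h₂ h₁ (by linarith)]

lemma theta_eq {m : ℕ} (hm : m ≠ 0) (ε : ℝ) :
    theta m ε = Real.pi / 2 - Real.pi / 2 * (m : ℝ)⁻¹ - 2 * ε := by
  have : (m : ℝ) ≠ 0 := by exact_mod_cast hm
  unfold theta
  field_simp

/-- The angle `theta m ε` is nondecreasing in `m ≥ 1`. -/
lemma theta_mono {n m : ℕ} (hn : 0 < n) (hnm : n ≤ m) (ε : ℝ) : theta n ε ≤ theta m ε := by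
  rw [theta_eq hn.ne', theta_eq (by omega)]
  have : (m : ℝ)⁻¹ ≤ (n : ℝ)⁻¹ := inv_anti₀ (by exact_mod_cast hn) (by exact_mod_cast hnm)
  gcongr

/-- (Lemma 2.2) There is `ε > 0` satisfying `(♠)`, i.e.
`(π/2 + ε) + (π/(2m) + ε) ≤ π − ε` for every `m ≥ 2`, and such that for any exponent
matrix `M` of hyperbolic type and any cycle `s_0, …, s_{k−1}` in its defining graph
(pairwise distinct vertices with all consecutive exponents `m_i` finite), one has
`Σ_i (θ(m_i, ε) − ε) ≥ π + ε`. -/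
theorem exists_eps_for_hyperbolic_type :
    ∃ ε : ℝ, 0 < ε ∧
      (∀ m : ℕ, 2 ≤ m →
        (Real.pi / 2 + ε) + (Real.pi / (2 * m) + ε) ≤ Real.pi - ε) ∧
      (∀ (S : Type) (M : S → S → ℕ∞),
        (∀ s t, M s t = M t s) →
        (∀ s t, s ≠ t → 2 ≤ M s t) →
        (∀ s t r : S, s ≠ t → t ≠ r → s ≠ r →
          expInv (M s t) + expInv (M t r) + expInv (M s r) < 1) →
        ∀ (k : ℕ) (hk : 3 ≤ k) (v : Fin k → S), Function.Injective v →
          ∀ mi : Fin k → ℕ,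
            (∀ i : Fin k,
              M (v i) (v ⟨(i.val + 1) % k, Nat.mod_lt _ (by omega)⟩) = (mi i : ℕ∞)) →
            Real.pi + ε ≤ ∑ i : Fin k, (theta (mi i) ε - ε)) := by
  have hpi := Real.pi_pos
  refine ⟨Real.pi / 840, by positivity, fun m hm ↦ ?_, ?_⟩
  · have : Real.pi / (2 * m) ≤ Real.pi / (2 * 2) := by gcongr; exact_mod_cast hm
    linarith
  intro S M hsymm hM hhyp k hk v hv mi hmi
  set ε := Real.pi / 840 with hε
  have hne : ∀ (i j : ℕ) (hi : i < k) (hj : j < k), i ≠ j → v ⟨i, hi⟩ ≠ v ⟨j, hj⟩ :=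
    fun i j hi hj hij h ↦ hij (congrArg Fin.val (hv h))
  have hmi₂ : ∀ i, 2 ≤ mi i := by
    intro i
    have h : (2 : ℕ∞) ≤ mi i := by
      rw [← hmi i]
      refine hM _ _ (hne _ _ i.2 _ ?_)
      have hi := i.2
      rcases Nat.lt_or_ge (i.val + 1) k with h | h
      · rw [Nat.mod_eq_of_lt h]
        omega
      · rw [show i.val + 1 = k by omega, Nat.mod_self]
        omega
    exact_mod_cast h
  have hθ₂ : ∀ i, Real.pi / 4 - 2 * ε ≤ theta (mi i) ε := by
    intro i
    have := theta_mono two_pos (hmi₂ i) ε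
    rw [theta_eq two_ne_zero] at this
    norm_num at this
    linarith
  obtain rfl | rfl | hk₅ : k = 3 ∨ k = 4 ∨ 5 ≤ k := by omega
  · have h₀ : M (v 0) (v 1) = mi 0 := hmi 0
    have h₁ : M (v 1) (v 2) = mi 1 := hmi 1
    have h₂ : M (v 0) (v 2) = mi 2 := (hsymm _ _).trans (hmi 2)
    have h := hhyp (v 0) (v 1) (v 2) (hv.ne (by decide)) (hv.ne (by decide)) (hv.ne (by decide))
    rw [h₀, h₁, h₂] at h
    simp only [expInv, ENat.toNat_natCast] at h
    have hsum := inv_add_inv_add_inv_le (hmi₂ 0) (hmi₂ 1) (hmi₂ 2) h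
    have hmul := mul_le_mul_of_nonneg_left hsum hpi.le
    have hz : ∀ i, mi i ≠ 0 := fun i ↦ by have := hmi₂ i; omega
    rw [Fin.sum_univ_three, theta_eq (hz 0), theta_eq (hz 1), theta_eq (hz 2)]
    linarith
  · have h₀ : M (v 0) (v 1) = mi 0 := hmi 0
    have h₁ : M (v 1) (v 2) = mi 1 := hmi 1
    have h := hhyp (v 0) (v 1) (v 2) (hv.ne (by decide)) (hv.ne (by decide)) (hv.ne (by decide))
    rw [h₀, h₁] at h
    simp only [expInv, ENat.toNat_natCast] at h
    have hnonneg : (0 : ℝ) ≤ ((M (v 0) (v 2)).toNat : ℝ)⁻¹ := by positivity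
    have hθ₃ : ∀ i, 3 ≤ mi i → Real.pi / 3 - 2 * ε ≤ theta (mi i) ε := by
      intro i hi
      have := theta_mono three_pos hi ε
      rw [theta_eq three_ne_zero] at this
      norm_num at this
      linarith
    have hor : 3 ≤ mi 0 ∨ 3 ≤ mi 1 := by
      by_contra! hlt
      have e₀ : mi 0 = 2 := by have := hmi₂ 0; omega
      have e₁ : mi 1 = 2 := by have := hmi₂ 1; omega
      rw [e₀, e₁] at h
      norm_num at h
      linarith
    rw [Fin.sum_univ_four]
    have := hθ₂ 0
    have := hθ₂ 1
    have := hθ₂ 2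
    have := hθ₂ 3
    rcases hor with h | h <;> linarith [hθ₃ _ h]
  · calc Real.pi + ε ≤ 5 * (Real.pi / 4 - 3 * ε) := by linarith
      _ ≤ k * (Real.pi / 4 - 3 * ε) := by
        gcongr
        · linarith
        · exact_mod_cast hk₅
      _ = ∑ _i : Fin k, (Real.pi / 4 - 3 * ε) := by simp [mul_sub]
      _ ≤ ∑ i : Fin k, (theta (mi i) ε - ε) :=
        Finset.sum_le_sum fun i _ ↦ by linarith [hθ₂ i]
end
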